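/- arXiv:1903.04287 — 6 statements merged into one kernel-verified Lean document; each statement's English description precedes it below -/
import Mathlib

section
/- A non-unimodular pair (X,Y) = ((x11,0; x21,x22), (y11,0; y21,y22)) of ²T(q) generates a free cyclic submodule T(q)(X,Y) if and only if x22 = y22 = 0 and x11·y21 − x21·y11 ≠ 0 (equivalently, x22 = y22 = 0 and one of the following holds: x11 = 0, y11 ≠ 0, x21 ≠ 0; or x11 ≠ 0, y11 = 0, y21 ≠ 0; or x11 ≠ 0, y11 ≠ 0, x21 = 0, y21 ≠ 0; or x11 ≠ 0, y11 ≠ 0, x21 ≠ 0, y21 ≠ x11⁻¹·x21·y11). -/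
open Matrix

/-- `Mat n F` is the type of `n × n` matrices over `F`. -/
abbrev Mat (n : ℕ) (F : Type) : Type := Matrix (Fin n) (Fin n) F

/-- A matrix is lower triangular (i.e. belongs to the ring `T_n(q)`)
if all entries above the diagonal vanish. -/
def LowerTri {n : ℕ} {F : Type} [Zero F] (X : Mat n F) : Prop :=
  ∀ i j : Fin n, i < j → X i j = 0

/-- The cyclic left submodule `T_n(q)(X,Y)` of `²T_n(q)` generated by the pair `(X,Y)`. -/
def cyc {n : ℕ} {F : Type} [Field F] (X Y : Mat n F) : Set (Mat n F × Mat n F) :=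
  {p | ∃ A : Mat n F, LowerTri A ∧ p = (A * X, A * Y)}

/-- The pair `(X,Y)` generates a *free* cyclic submodule:
`A • (X,Y) = (0,0)` with `A ∈ T_n(q)` forces `A = 0`. -/
def IsFreePair {n : ℕ} {F : Type} [Field F] (X Y : Mat n F) : Prop :=
  ∀ A : Mat n F, LowerTri A → A * X = 0 → A * Y = 0 → A = 0

/-- A pair `(X,Y)` is unimodular if for every index `i` one of the `i`-th
diagonal entries of `X`, `Y` is nonzero. -/
def Unimodular {n : ℕ} {F : Type} [Field F] (X Y : Mat n F) : Prop :=
  ∀ i : Fin n, X i i ≠ 0 ∨ Y i i ≠ 0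

/-- `M` is a free cyclic submodule of `²T_n(q)`. -/
def IsFreeCyc {n : ℕ} {F : Type} [Field F] (M : Set (Mat n F × Mat n F)) : Prop :=
  ∃ X Y : Mat n F, LowerTri X ∧ LowerTri Y ∧ IsFreePair X Y ∧ M = cyc X Y

/-- `M` is a free cyclic submodule of `²T_n(q)` generated by a non-unimodular pair. -/
def IsNonUnimodFreeCyc {n : ℕ} {F : Type} [Field F] (M : Set (Mat n F × Mat n F)) : Prop :=
  ∃ X Y : Mat n F, LowerTri X ∧ LowerTri Y ∧ ¬ Unimodular X Y ∧ IsFreePair X Y ∧ M = cyc X Y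

/-- Freeness of a pair of lower triangular `2 × 2` matrices, in coordinates. -/
theorem isFreePair_two_iff {F : Type} [Field F] (x11 x21 x22 y11 y21 y22 : F) :
    IsFreePair !![x11, 0; x21, x22] !![y11, 0; y21, y22] ↔
      ∀ a b c : F, a * x11 = 0 → a * y11 = 0 → b * x11 + c * x21 = 0 → b * y11 + c * y21 = 0 →
        c * x22 = 0 → c * y22 = 0 → a = 0 ∧ b = 0 ∧ c = 0 := by
  constructor
  · intro h a b c h1 h2 h3 h4 h5 h6
    have hA : (!![a, 0; b, c] : Mat 2 F) = 0 := by
      apply h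
      · intro i j hij
        fin_cases i <;> fin_cases j <;> simp_all
      · ext i j
        fin_cases i <;> fin_cases j <;> simp [Matrix.mul_apply, Fin.sum_univ_two, *]
      · ext i j
        fin_cases i <;> fin_cases j <;> simp [Matrix.mul_apply, Fin.sum_univ_two, *]
    exact ⟨by simpa using congrFun₂ hA 0 0, by simpa using congrFun₂ hA 1 0,
      by simpa using congrFun₂ hA 1 1⟩
  · intro h A hA hX hY
    have h01 : A 0 1 = 0 := hA 0 1 (by decide)
    have entry {B C : Mat 2 F} (hB : B * C = 0) (i j : Fin 2) :
        B i 0 * C 0 j + B i 1 * C 1 j = 0 := by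
      simpa [Matrix.mul_apply, Fin.sum_univ_two] using congrFun₂ hB i j
    obtain ⟨ha, hb, hc⟩ := h (A 0 0) (A 1 0) (A 1 1)
      (by simpa [h01] using entry hX 0 0) (by simpa [h01] using entry hY 0 0)
      (by simpa using entry hX 1 0) (by simpa using entry hY 1 0)
      (by simpa using entry hX 1 1) (by simpa using entry hY 1 1)
    ext i j
    fin_cases i <;> fin_cases j <;> simp [ha, hb, hc, h01]

/-- A non-unimodular pair of lower triangular `2 × 2` matrices is free if and only if its second
diagonal entries vanish and its first columns are linearly independent. -/
theorem isFreePair_two_iff_det_ne_zero {F : Type} [Field F] {x11 x21 x22 y11 y21 y22 : F}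
    (hnu : ¬ Unimodular !![x11, 0; x21, x22] !![y11, 0; y21, y22]) :
    IsFreePair !![x11, 0; x21, x22] !![y11, 0; y21, y22] ↔
      x22 = 0 ∧ y22 = 0 ∧ x11 * y21 - x21 * y11 ≠ 0 := by
  rw [isFreePair_two_iff]
  constructor
  · intro h
    have h1 : ¬ (x11 = 0 ∧ y11 = 0) := by
      rintro ⟨hx, hy⟩
      simpa using (h 1 0 0 (by simp [hx]) (by simp [hy]) (by simp) (by simp) (by simp)
        (by simp)).1
    have h2 : x22 = 0 ∧ y22 = 0 := by
      simp only [Unimodular, Fin.forall_fin_two] at hnu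
      simp at hnu
      tauto
    refine ⟨h2.1, h2.2, fun hd => h1 ⟨?_, ?_⟩⟩
    · exact neg_eq_zero.mp (h 0 x21 (-x11) (by simp) (by simp) (by ring)
        (by linear_combination -hd) (by simp [h2]) (by simp [h2])).2.2
    · exact neg_eq_zero.mp (h 0 y21 (-y11) (by simp) (by simp) (by linear_combination hd)
        (by ring) (by simp [h2]) (by simp [h2])).2.2
  · rintro ⟨-, -, hd⟩ a b c h1 h2 h3 h4 - -
    refine ⟨?_, ?_, ?_⟩ <;> refine (mul_eq_zero_iff_right hd).mp ?_
    · linear_combination y21 * h1 - x21 * h2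
    · linear_combination y21 * h3 - x21 * h4
    · linear_combination x11 * h4 - y11 * h3

/-- Case description of the nonvanishing of a `2 × 2` determinant. -/
theorem mul_sub_mul_ne_zero_iff_cases {F : Type} [Field F] (x11 x21 y11 y21 : F) :
    x11 * y21 - x21 * y11 ≠ 0 ↔
      (x11 = 0 ∧ y11 ≠ 0 ∧ x21 ≠ 0) ∨
      (x11 ≠ 0 ∧ y11 = 0 ∧ y21 ≠ 0) ∨
      (x11 ≠ 0 ∧ y11 ≠ 0 ∧ x21 = 0 ∧ y21 ≠ 0) ∨
      (x11 ≠ 0 ∧ y11 ≠ 0 ∧ x21 ≠ 0 ∧ y21 ≠ x11⁻¹ * x21 * y11) := by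
  by_cases hx : x11 = 0
  · simp [hx, and_comm]
  by_cases hy : y11 = 0
  · simp [hx, hy]
  by_cases hz : x21 = 0
  · simp [hx, hy, hz]
  · simp [hx, hy, hz, sub_eq_zero, mul_assoc, eq_inv_mul_iff_mul_eq₀ hx]

theorem stmt_2 (q : ℕ) (hq : 2 ≤ q)
    (F : Type) [Field F] [Fintype F] (hF : Fintype.card F = q)
    (x11 x21 x22 y11 y21 y22 : F)
    (hnu : ¬ Unimodular !![x11, 0; x21, x22] !![y11, 0; y21, y22]) :
    (IsFreePair !![x11, 0; x21, x22] !![y11, 0; y21, y22] ↔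
      x22 = 0 ∧ y22 = 0 ∧ x11 * y21 - x21 * y11 ≠ 0) ∧
    (IsFreePair !![x11, 0; x21, x22] !![y11, 0; y21, y22] ↔
      x22 = 0 ∧ y22 = 0 ∧
        ((x11 = 0 ∧ y11 ≠ 0 ∧ x21 ≠ 0) ∨
         (x11 ≠ 0 ∧ y11 = 0 ∧ y21 ≠ 0) ∨
         (x11 ≠ 0 ∧ y11 ≠ 0 ∧ x21 = 0 ∧ y21 ≠ 0) ∨
         (x11 ≠ 0 ∧ y11 ≠ 0 ∧ x21 ≠ 0 ∧ y21 ≠ x11⁻¹ * x21 * y11))) := by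
  have h := isFreePair_two_iff_det_ne_zero hnu
  exact ⟨h, by rw [h, mul_sub_mul_ne_zero_iff_cases]⟩
end

section
/- The set of free cyclic submodules of ²T(q) generated by non-unimodular pairs equals { T(q)((1,0; 0,0), (0,0; 1,0)) } ∪ { T(q)((k,0; 1,0), (1,0; 0,0)) : k ∈ F }, and the q+1 submodules in this list are pairwise distinct. In particular, there are exactly q+1 free cyclic submodules of ²T(q) generated by non-unimodular pairs. -/
open Matrix

/-- The pairs of matrices supported on the first column whose first row `(x₁₁, y₁₁)` lies on the
line spanned by `(a, e)`. -/
def lineSet {F : Type} [Field F] (a e : F) : Set (Mat 2 F × Mat 2 F) :=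
  {p | ∃ u s t : F, p = (!![u * a, 0; s, 0], !![u * e, 0; t, 0])}

theorem lowerTri_iff_exists {F : Type} [Field F] (X : Mat 2 F) :
    LowerTri X ↔ ∃ a c d : F, X = !![a, 0; c, d] := by
  constructor
  · intro h
    refine ⟨X 0 0, X 1 0, X 1 1, ?_⟩
    have h01 := h 0 1 (by decide)
    ext i j
    fin_cases i <;> fin_cases j <;> simp [h01]
  · rintro ⟨a, c, d, rfl⟩ i j hij
    fin_cases i <;> fin_cases j <;> simp_all

theorem cyc_eq_lineSet {F : Type} [Field F] {a c e g : F} (h : a * g - e * c ≠ 0) :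
    cyc !![a, 0; c, 0] !![e, 0; g, 0] = lineSet a e := by
  ext p
  constructor
  · rintro ⟨A, hA, rfl⟩
    obtain ⟨u, v, w, rfl⟩ := (lowerTri_iff_exists A).1 hA
    exact ⟨u, v * a + w * c, v * e + w * g, by simp⟩
  · rintro ⟨u, s, t, rfl⟩
    refine ⟨!![u, 0; (s * g - t * c) / (a * g - e * c), (a * t - e * s) / (a * g - e * c)],
      (lowerTri_iff_exists _).2 ⟨_, _, _, rfl⟩, ?_⟩
    have h₁ : s = (s * g - t * c) / (a * g - e * c) * a
        + (a * t - e * s) / (a * g - e * c) * c := by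
      rw [div_mul_eq_mul_div, div_mul_eq_mul_div, ← add_div, eq_div_iff h]
      ring
    have h₂ : t = (s * g - t * c) / (a * g - e * c) * e
        + (a * t - e * s) / (a * g - e * c) * g := by
      rw [div_mul_eq_mul_div, div_mul_eq_mul_div, ← add_div, eq_div_iff h]
      ring
    simp [← h₁, ← h₂]

theorem lineSet_mul {F : Type} [Field F] {r : F} (hr : r ≠ 0) (a e : F) :
    lineSet (r * a) (r * e) = lineSet a e := by
  ext p
  constructor
  · rintro ⟨u, s, t, rfl⟩
    exact ⟨u * r, s, t, by simp [mul_assoc]⟩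
  · rintro ⟨u, s, t, rfl⟩
    exact ⟨u / r, s, t, by simp [← mul_assoc, hr]⟩

theorem mul_eq_mul_of_lineSet_eq {F : Type} [Field F] {a e b f : F}
    (h : lineSet a e = lineSet b f) : a * f = e * b := by
  have hm : (!![a, 0; 0, 0], !![e, 0; 0, 0]) ∈ lineSet b f :=
    h ▸ ⟨1, 0, 0, by simp⟩
  obtain ⟨u, s, t, hp⟩ := hm
  have h₁ : a = u * b := by simpa using congrFun (congrFun (congrArg Prod.fst hp) 0) 0
  have h₂ : e = u * f := by simpa using congrFun (congrFun (congrArg Prod.snd hp) 0) 0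
  rw [h₁, h₂]
  ring

theorem isFreePair_of_det_ne_zero {F : Type} [Field F] {a c e g : F} (h : a * g - e * c ≠ 0) :
    IsFreePair !![a, 0; c, 0] !![e, 0; g, 0] := by
  intro A hA hX hY
  obtain ⟨u, v, w, rfl⟩ := (lowerTri_iff_exists A).1 hA
  have x₀ : u * a = 0 := by simpa using congrFun (congrFun hX 0) 0
  have y₀ : u * e = 0 := by simpa using congrFun (congrFun hY 0) 0
  have x₁ : v * a + w * c = 0 := by simpa using congrFun (congrFun hX 1) 0
  have y₁ : v * e + w * g = 0 := by simpa using congrFun (congrFun hY 1) 0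
  have hu : u = 0 := (mul_eq_zero.1 (show u * (a * g - e * c) = 0 by
    linear_combination g * x₀ - c * y₀)).resolve_right h
  have hv : v = 0 := (mul_eq_zero.1 (show v * (a * g - e * c) = 0 by
    linear_combination g * x₁ - c * y₁)).resolve_right h
  have hw : w = 0 := (mul_eq_zero.1 (show w * (a * g - e * c) = 0 by
    linear_combination a * y₁ - e * x₁)).resolve_right h
  ext i j
  fin_cases i <;> fin_cases j <;> simp [hu, hv, hw]

theorem IsFreePair.fst_row_ne_zero {F : Type} [Field F] {a c d e g h : F}
    (hfree : IsFreePair !![a, 0; c, d] !![e, 0; g, h]) : a ≠ 0 ∨ e ≠ 0 := by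
  by_contra! hae
  have hA := hfree !![0, 0; 1, 0] ((lowerTri_iff_exists _).2 ⟨_, _, _, rfl⟩)
    (by ext i j; fin_cases i <;> fin_cases j <;> simp [hae.1])
    (by ext i j; fin_cases i <;> fin_cases j <;> simp [hae.2])
  simpa using congrFun (congrFun hA 1) 0

theorem IsFreePair.det_ne_zero {F : Type} [Field F] {a c e g : F}
    (hfree : IsFreePair !![a, 0; c, 0] !![e, 0; g, 0]) : a * g - e * c ≠ 0 := by
  intro hdet
  have key : ∀ v w : F, v * a + w * c = 0 → v * e + w * g = 0 → v = 0 ∧ w = 0 := by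
    intro v w hX hY
    have hA := hfree !![0, 0; v, w] ((lowerTri_iff_exists _).2 ⟨_, _, _, rfl⟩)
      (by ext i j; fin_cases i <;> fin_cases j <;> simp [hX])
      (by ext i j; fin_cases i <;> fin_cases j <;> simp [hY])
    exact ⟨by simpa using congrFun (congrFun hA 1) 0, by simpa using congrFun (congrFun hA 1) 1⟩
  have ha := (key c (-a) (by ring) (by linear_combination -hdet)).2
  have he := (key g (-e) (by linear_combination hdet) (by ring)).2
  rcases hfree.fst_row_ne_zero with h | h
  · exact h (neg_eq_zero.1 ha)
  · exact h (neg_eq_zero.1 he)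

theorem isNonUnimodFreeCyc_iff_exists_lineSet {F : Type} [Field F]
    (M : Set (Mat 2 F × Mat 2 F)) :
    IsNonUnimodFreeCyc M ↔ ∃ a e : F, (a ≠ 0 ∨ e ≠ 0) ∧ M = lineSet a e := by
  constructor
  · rintro ⟨X, Y, hX, hY, hU, hfree, rfl⟩
    obtain ⟨a, c, d, rfl⟩ := (lowerTri_iff_exists X).1 hX
    obtain ⟨e, g, h, rfl⟩ := (lowerTri_iff_exists Y).1 hY
    have hae := hfree.fst_row_ne_zero
    have hdh : d = 0 ∧ h = 0 := by
      simpa [Unimodular, Fin.forall_fin_two, hae] using hU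
    obtain ⟨rfl, rfl⟩ := hdh
    exact ⟨a, e, hae, cyc_eq_lineSet hfree.det_ne_zero⟩
  · rintro ⟨a, e, hae, rfl⟩
    obtain ⟨c, g, hdet⟩ : ∃ c g : F, a * g - e * c ≠ 0 := by
      rcases hae with h | h
      · exact ⟨0, 1, by simpa using h⟩
      · exact ⟨1, 0, by simpa using h⟩
    exact ⟨_, _, (lowerTri_iff_exists _).2 ⟨_, _, _, rfl⟩, (lowerTri_iff_exists _).2 ⟨_, _, _, rfl⟩,
      fun hU => by simpa using hU 1, isFreePair_of_det_ne_zero hdet, (cyc_eq_lineSet hdet).symm⟩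

theorem stmt_3 (q : ℕ) (hq : 2 ≤ q)
    (F : Type) [Field F] [Fintype F] (hF : Fintype.card F = q) :
    {M : Set (Mat 2 F × Mat 2 F) | IsNonUnimodFreeCyc M}
      = insert (cyc !![(1 : F), 0; 0, 0] !![0, 0; 1, 0])
          {M | ∃ k : F, M = cyc !![k, 0; 1, 0] !![1, 0; 0, 0]} ∧
    (∀ k : F, cyc !![(1 : F), 0; 0, 0] !![0, 0; 1, 0]
      ≠ cyc !![k, 0; 1, 0] !![1, 0; 0, 0]) ∧
    (∀ k l : F, cyc !![k, 0; 1, 0] !![(1 : F), 0; 0, 0]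
      = cyc !![l, 0; 1, 0] !![1, 0; 0, 0] → k = l) ∧
    Set.ncard {M : Set (Mat 2 F × Mat 2 F) | IsNonUnimodFreeCyc M} = q + 1 := by
  have hinf : cyc !![(1 : F), 0; 0, 0] !![0, 0; 1, 0] = lineSet 1 0 := cyc_eq_lineSet (by simp)
  have haff : ∀ k : F, cyc !![k, 0; 1, 0] !![1, 0; 0, 0] = lineSet k 1 :=
    fun k => cyc_eq_lineSet (by simp)
  simp only [hinf, haff]
  have hset : {M : Set (Mat 2 F × Mat 2 F) | IsNonUnimodFreeCyc M}
      = insert (lineSet 1 0) {M | ∃ k : F, M = lineSet k 1} := by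
    ext M
    simp only [Set.mem_ofPred_eq, Set.mem_insert_iff, isNonUnimodFreeCyc_iff_exists_lineSet]
    constructor
    · rintro ⟨a, e, hae, rfl⟩
      by_cases he : e = 0
      · subst he
        have ha : a ≠ 0 := by simpa using hae
        exact Or.inl (by simpa using lineSet_mul ha 1 0)
      · exact Or.inr ⟨a / e, by simpa [mul_div_cancel₀ a he] using lineSet_mul he (a / e) 1⟩
    · rintro (rfl | ⟨k, rfl⟩)
      · exact ⟨1, 0, by simp, rfl⟩
      · exact ⟨k, 1, by simp, rfl⟩
  have hne : ∀ k : F, lineSet (1 : F) 0 ≠ lineSet k 1 := fun k h => by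
    simpa using mul_eq_mul_of_lineSet_eq h
  have hinj : ∀ k l : F, lineSet k 1 = lineSet l 1 → k = l := fun k l h => by
    simpa using mul_eq_mul_of_lineSet_eq h
  refine ⟨hset, hne, hinj, ?_⟩
  have hrange : {M : Set (Mat 2 F × Mat 2 F) | ∃ k : F, M = lineSet k 1}
      = Set.range fun k : F => lineSet k 1 := by
    ext M
    simp [eq_comm]
  rw [hset, hrange, Set.ncard_insert_of_notMem (by rintro ⟨k, hk⟩; exact hne k hk.symm)
    (Set.finite_range _), ← Set.image_univ, Set.ncard_image_of_injective _ hinj, Set.ncard_univ,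
    Nat.card_eq_fintype_card, hF]
end

section
/- Exactly (q−1)²·q·(q+1) non-unimodular pairs (X,Y) ∈ ²T(q) generate a free cyclic submodule T(q)(X,Y). Moreover, each free cyclic submodule of ²T(q) generated by a non-unimodular pair is generated by exactly (q−1)²·q distinct non-unimodular pairs. -/
open Matrix

section LowerTriangularPairs

variable {F : Type} [Field F]

lemma lowerTri_of (a b c : F) : LowerTri !![a, 0; b, c] := by
  intro i j h
  fin_cases i <;> fin_cases j <;> simp_all

lemma LowerTri.eq_of {X : Mat 2 F} (h : LowerTri X) : X = !![X 0 0, 0; X 1 0, X 1 1] := by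
  have h01 := h 0 1 (by decide)
  ext i j
  fin_cases i <;> fin_cases j <;> simp [h01]

lemma LowerTri.mul {A B : Mat 2 F} (hA : LowerTri A) (hB : LowerTri B) : LowerTri (A * B) := by
  rw [hA.eq_of, hB.eq_of]
  intro i j h
  fin_cases i <;> fin_cases j <;> simp_all

lemma mul_lowerTri (a b c x z t : F) :
    !![a, 0; b, c] * !![x, 0; z, t] = !![a * x, 0; b * x + c * z, c * t] := by
  simp

lemma lowerTri_eq_iff (a b c x z t : F) :
    (!![a, 0; b, c] : Mat 2 F) = !![x, 0; z, t] ↔ a = x ∧ b = z ∧ c = t := by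
  constructor
  · intro h
    exact ⟨congrFun₂ h 0 0, congrFun₂ h 1 0, congrFun₂ h 1 1⟩
  · rintro ⟨rfl, rfl, rfl⟩
    rfl

lemma lowerTri_eq_zero_iff (a b c : F) :
    (!![a, 0; b, c] : Mat 2 F) = 0 ↔ a = 0 ∧ b = 0 ∧ c = 0 := by
  rw [← lowerTri_eq_iff, Matrix.eta_fin_two (0 : Mat 2 F)]
  rfl

lemma isFreePair_iff_det_ne_zero (x y z w : F) :
    IsFreePair !![x, 0; z, 0] !![y, 0; w, 0] ↔ x * w - y * z ≠ 0 := by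
  have free_iff : IsFreePair !![x, 0; z, 0] !![y, 0; w, 0] ↔
      ∀ a b c : F, a * x = 0 → a * y = 0 → b * x + c * z = 0 → b * y + c * w = 0 →
        a = 0 ∧ b = 0 ∧ c = 0 := by
    constructor
    · intro h a b c h1 h2 h3 h4
      rw [← lowerTri_eq_zero_iff]
      apply h _ (lowerTri_of a b c) <;> rw [mul_lowerTri, lowerTri_eq_zero_iff] <;> simp [*]
    · intro h A hA h1 h2
      rw [hA.eq_of] at h1 h2 ⊢
      rw [mul_lowerTri, lowerTri_eq_zero_iff] at h1 h2
      rw [lowerTri_eq_zero_iff]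
      exact h _ _ _ h1.1 h2.1 h1.2.1 h2.2.1
  rw [free_iff]
  constructor
  · intro h hd
    obtain ⟨-, hw, hy⟩ := h 0 w (-y) (by simp) (by simp) (by linear_combination hd) (by ring)
    obtain ⟨-, hz, hx⟩ := h 0 z (-x) (by simp) (by simp) (by ring) (by linear_combination -hd)
    rw [neg_eq_zero] at hx hy
    exact one_ne_zero (h 1 0 0 (by simp [hx]) (by simp [hy]) (by simp) (by simp)).1
  · intro hd a b c h1 h2 h3 h4
    refine ⟨?_, ?_, ?_⟩ <;> apply (mul_eq_zero.mp _).resolve_right hd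
    · linear_combination w * h1 - z * h2
    · linear_combination w * h3 - z * h4
    · linear_combination x * h4 - y * h3

lemma IsFreePair.bottom_eq_zero {X Y : Mat 2 F} (hX : LowerTri X) (hY : LowerTri Y)
    (hu : ¬ Unimodular X Y) (hf : IsFreePair X Y) : X 1 1 = 0 ∧ Y 1 1 = 0 := by
  simp only [Unimodular, Fin.forall_fin_two, not_and_or, not_or, not_not] at hu
  refine hu.resolve_left fun ⟨hx, hy⟩ => ?_
  have h := hf _ (lowerTri_of 1 0 0)
    (by rw [hX.eq_of, mul_lowerTri, lowerTri_eq_zero_iff]; simp [hx])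
    (by rw [hY.eq_of, mul_lowerTri, lowerTri_eq_zero_iff]; simp [hy])
  rw [lowerTri_eq_zero_iff] at h
  exact one_ne_zero h.1

lemma not_unimodular_of_bottom (X Y : Mat 2 F) (hX : X 1 1 = 0) (hY : Y 1 1 = 0) :
    ¬ Unimodular X Y := fun h => (h 1).elim (· hX) (· hY)

lemma ncard_nonUnimodular_free [Fintype F] :
    Set.ncard {p : Mat 2 F × Mat 2 F |
        LowerTri p.1 ∧ LowerTri p.2 ∧ ¬ Unimodular p.1 p.2 ∧ IsFreePair p.1 p.2}
      = Nat.card (GL (Fin 2) F) := by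
  let f : GL (Fin 2) F → Mat 2 F × Mat 2 F :=
    fun g => (!![g.1 0 0, 0; g.1 1 0, 0], !![g.1 0 1, 0; g.1 1 1, 0])
  have hf : Function.Injective f := by
    intro g g' h
    simp only [f, Prod.mk.injEq, lowerTri_eq_iff] at h
    ext i j
    fin_cases i <;> fin_cases j <;> simp [h]
  rw [← Set.ncard_univ, ← Set.ncard_image_of_injective _ hf, Set.image_univ]
  congr 1
  ext ⟨X, Y⟩
  constructor
  · rintro ⟨hX, hY, hu, h⟩
    dsimp only at hX hY hu h
    obtain ⟨hx, hy⟩ := h.bottom_eq_zero hX hY hu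
    have hX' := hX.eq_of
    have hY' := hY.eq_of
    rw [hx] at hX'
    rw [hy] at hY'
    rw [hX', hY', isFreePair_iff_det_ne_zero] at h
    refine ⟨Matrix.GeneralLinearGroup.mkOfDetNeZero !![X 0 0, Y 0 0; X 1 0, Y 1 0]
      (by rwa [Matrix.det_fin_two_of]), ?_⟩
    exact Prod.ext hX'.symm hY'.symm
  · rintro ⟨g, hg⟩
    obtain ⟨rfl, rfl⟩ := Prod.mk.inj hg
    refine ⟨lowerTri_of _ _ _, lowerTri_of _ _ _, not_unimodular_of_bottom _ _ rfl rfl, ?_⟩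
    rw [isFreePair_iff_det_ne_zero, ← Matrix.det_fin_two]
    exact g.det_ne_zero

lemma IsFreePair.mul_right_cancel {X Y A B : Mat 2 F} (hf : IsFreePair X Y)
    (hA : LowerTri A) (hB : LowerTri B) (hX : A * X = B * X) (hY : A * Y = B * Y) : A = B := by
  refine sub_eq_zero.mp (hf _ (fun i j h => ?_) ?_ ?_)
  · simp [hA i j h, hB i j h]
  · rw [Matrix.sub_mul, hX, sub_self]
  · rw [Matrix.sub_mul, hY, sub_self]

lemma mem_cyc_self (X Y : Mat 2 F) : (X, Y) ∈ cyc X Y :=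
  ⟨1, fun _ _ h => Matrix.one_apply_ne h.ne, by simp⟩

lemma cyc_mul_subset (X Y : Mat 2 F) {A : Mat 2 F} (hA : LowerTri A) :
    cyc (A * X) (A * Y) ⊆ cyc X Y := by
  rintro _ ⟨B, hB, rfl⟩
  exact ⟨B * A, hB.mul hA, by simp only [Matrix.mul_assoc]⟩

lemma cyc_mul_eq (X Y : Mat 2 F) (a c : Fˣ) (b : F) :
    cyc (!![(a : F), 0; b, (c : F)] * X) (!![(a : F), 0; b, (c : F)] * Y) = cyc X Y := by
  refine (cyc_mul_subset X Y (lowerTri_of _ _ _)).antisymm ?_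
  have hinv : !![(↑a⁻¹ : F), 0; -(b * ↑a⁻¹ * ↑c⁻¹ : F), (↑c⁻¹ : F)] * !![(a : F), 0; b, (c : F)]
      = 1 := by
    rw [mul_lowerTri, Matrix.one_fin_two, lowerTri_eq_iff]
    refine ⟨by simp, ?_, by simp⟩
    linear_combination (-(b * (↑c⁻¹ : F))) * a.inv_mul
  have := cyc_mul_subset (!![(a : F), 0; b, (c : F)] * X) (!![(a : F), 0; b, (c : F)] * Y)
    (lowerTri_of (↑a⁻¹ : F) (-(b * ↑a⁻¹ * ↑c⁻¹ : F)) (↑c⁻¹ : F))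
  rwa [← Matrix.mul_assoc, ← Matrix.mul_assoc, hinv, Matrix.one_mul, Matrix.one_mul] at this

lemma IsFreePair.ncard_generators {X Y : Mat 2 F} (hX : LowerTri X) (hY : LowerTri Y)
    (hu : ¬ Unimodular X Y) (hf : IsFreePair X Y) :
    Set.ncard {p : Mat 2 F × Mat 2 F |
        LowerTri p.1 ∧ LowerTri p.2 ∧ ¬ Unimodular p.1 p.2 ∧ cyc p.1 p.2 = cyc X Y}
      = Nat.card ((Fˣ × Fˣ) × F) := by
  let A : (Fˣ × Fˣ) × F → Mat 2 F := fun t => !![(t.1.1 : F), 0; t.2, (t.1.2 : F)]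
  have hA (t) : LowerTri (A t) := lowerTri_of _ _ _
  let f : (Fˣ × Fˣ) × F → Mat 2 F × Mat 2 F := fun t => (A t * X, A t * Y)
  have hinj : Function.Injective f := by
    intro s t h
    obtain ⟨h1, h2⟩ := Prod.mk.inj h
    have := hf.mul_right_cancel (hA s) (hA t) h1 h2
    simp only [A, lowerTri_eq_iff, Units.val_inj] at this
    exact Prod.ext (Prod.ext this.1 this.2.2) this.2.1
  rw [← Set.ncard_univ, ← Set.ncard_image_of_injective _ hinj, Set.image_univ]
  congr 1
  ext ⟨U, V⟩
  constructor
  · rintro ⟨-, -, -, h⟩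
    dsimp only at h
    obtain ⟨C, hC, hCe⟩ := h ▸ mem_cyc_self U V
    obtain ⟨B, hB, hBe⟩ := h.symm ▸ mem_cyc_self X Y
    obtain ⟨rfl, rfl⟩ := Prod.mk.inj hCe
    obtain ⟨h1, h2⟩ := Prod.mk.inj hBe
    have hBC : B * C = 1 := hf.mul_right_cancel (hB.mul hC)
      (fun _ _ h => Matrix.one_apply_ne h.ne)
      (by rw [Matrix.mul_assoc, ← h1, Matrix.one_mul])
      (by rw [Matrix.mul_assoc, ← h2, Matrix.one_mul])
    rw [hB.eq_of, hC.eq_of, mul_lowerTri, Matrix.one_fin_two, lowerTri_eq_iff] at hBC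
    refine ⟨((Units.mk0 (C 0 0) (right_ne_zero_of_mul_eq_one hBC.1),
      Units.mk0 (C 1 1) (right_ne_zero_of_mul_eq_one hBC.2.2)), C 1 0), ?_⟩
    simp only [f, A, Units.val_mk0, ← hC.eq_of]
  · rintro ⟨t, ht⟩
    obtain ⟨rfl, rfl⟩ := Prod.mk.inj ht
    obtain ⟨hx, hy⟩ := hf.bottom_eq_zero hX hY hu
    refine ⟨(hA t).mul hX, (hA t).mul hY, not_unimodular_of_bottom _ _ ?_ ?_,
      cyc_mul_eq X Y _ _ _⟩ <;>
    simp [A, Matrix.mul_apply, Fin.sum_univ_two, hX 0 1 (by decide), hY 0 1 (by decide), hx, hy]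

end LowerTriangularPairs

theorem stmt_4 (q : ℕ) (hq : 2 ≤ q)
    (F : Type) [Field F] [Fintype F] (hF : Fintype.card F = q) :
    Set.ncard {p : Mat 2 F × Mat 2 F |
        LowerTri p.1 ∧ LowerTri p.2 ∧ ¬ Unimodular p.1 p.2 ∧ IsFreePair p.1 p.2}
      = (q - 1) ^ 2 * q * (q + 1) ∧
    ∀ M : Set (Mat 2 F × Mat 2 F), IsNonUnimodFreeCyc M →
      Set.ncard {p : Mat 2 F × Mat 2 F |
          LowerTri p.1 ∧ LowerTri p.2 ∧ ¬ Unimodular p.1 p.2 ∧ cyc p.1 p.2 = M}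
        = (q - 1) ^ 2 * q := by
  constructor
  · rw [ncard_nonUnimodular_free, Matrix.card_GL_field, Fin.prod_univ_two, hF]
    obtain ⟨k, rfl⟩ := Nat.exists_eq_add_of_le' (one_le_two.trans hq)
    have h1 : (k + 1) ^ 2 - 1 = k * (k + 2) := Nat.sub_eq_of_eq_add (by ring)
    have h2 : (k + 1) ^ 2 - (k + 1) = k * (k + 1) := Nat.sub_eq_of_eq_add (by ring)
    simp only [Fin.val_zero, Fin.val_one, pow_zero, pow_one, h1, h2, Nat.add_sub_cancel]
    ring
  · rintro M ⟨X, Y, hX, hY, hu, hf, rfl⟩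
    rw [hf.ncard_generators hX hY hu, Nat.card_prod, Nat.card_prod, Nat.card_units,
      Nat.card_eq_fintype_card, hF, sq]
end

section
/- Among the cyclic submodules of ²T(q) of cardinality q: exactly q+1 of them are generated by a pair (P,R) in which both P and R have all diagonal entries equal to zero, and exactly q²·(q+1) of them are generated by a pair (P,R) in which some diagonal entry of P or of R is nonzero. -/
open Matrix

section LowerTriangularPairs

variable {F : Type} [Field F]

/-- The pair of matrices with zero first row whose second rows are `(x.1.1, x.2.1)` and
`(x.1.2, x.2.2)`; thus `x.2` collects the diagonal entries. -/
def bottomPair (x : (F × F) × (F × F)) : Mat 2 F × Mat 2 F :=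
  (!![0, 0; x.1.1, x.2.1], !![0, 0; x.1.2, x.2.2])

/-- The image under `bottomPair` of the line spanned by `x`. -/
def bottomLine (x : (F × F) × (F × F)) : Set (Mat 2 F × Mat 2 F) :=
  Set.range fun u : F => bottomPair (u • x)

/-- The standard representatives of the lines in the plane `F × F`. -/
def lineRep : Option F → F × F
  | none => (0, 1)
  | some a => (1, a)

theorem bottomPair_injective : Function.Injective (bottomPair (F := F)) := by
  rintro ⟨⟨a, b⟩, c, d⟩ ⟨⟨a', b'⟩, c', d'⟩ h
  simp only [bottomPair, Prod.mk.injEq] at h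
  have h1 := congrFun₂ h.1 1
  have h2 := congrFun₂ h.2 1
  have h10 := h1 0
  have h11 := h1 1
  have h20 := h2 0
  have h21 := h2 1
  simp at h10 h11 h20 h21
  simp [h10, h11, h20, h21]

theorem cyc_bottomPair (x : (F × F) × (F × F)) :
    cyc (bottomPair x).1 (bottomPair x).2 = bottomLine x := by
  ext p
  simp only [cyc, bottomLine, Set.mem_ofPred_eq, Set.mem_range]
  constructor
  · rintro ⟨A, hA, rfl⟩
    refine ⟨A 1 1, ?_⟩
    have h01 : A 0 1 = 0 := hA 0 1 (by decide)
    ext i j <;> fin_cases i <;> fin_cases j <;>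
      simp [bottomPair, Matrix.mul_apply, Fin.sum_univ_two, h01]
  · rintro ⟨u, rfl⟩
    refine ⟨!![0, 0; 0, u], ?_, ?_⟩
    · intro i j hij
      fin_cases i <;> fin_cases j <;> simp_all
    · ext i j <;> fin_cases i <;> fin_cases j <;>
        simp [bottomPair, Matrix.mul_apply, Fin.sum_univ_two]

theorem lowerTri_bottomPair (x : (F × F) × (F × F)) :
    LowerTri (bottomPair x).1 ∧ LowerTri (bottomPair x).2 := by
  constructor <;> intro i j hij <;> fin_cases i <;> fin_cases j <;> simp_all [bottomPair]

theorem eq_bottomPair {P R : Mat 2 F} (hP : LowerTri P) (hR : LowerTri R)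
    (hP0 : P 0 0 = 0) (hR0 : R 0 0 = 0) :
    (P, R) = bottomPair ((P 1 0, R 1 0), (P 1 1, R 1 1)) := by
  have hP1 : P 0 1 = 0 := hP 0 1 (by decide)
  have hR1 : R 0 1 = 0 := hR 0 1 (by decide)
  ext i j <;> fin_cases i <;> fin_cases j <;> simp [bottomPair, *]

theorem bottomLine_smul {u : F} (hu : u ≠ 0) (x : (F × F) × (F × F)) :
    bottomLine (u • x) = bottomLine x := by
  ext p
  constructor
  · rintro ⟨v, rfl⟩
    exact ⟨v * u, by simp only [mul_smul]⟩
  · rintro ⟨v, rfl⟩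
    exact ⟨v * u⁻¹, by simp only [smul_smul, inv_mul_cancel_right₀ hu]⟩

theorem exists_smul_eq_of_bottomLine_eq {x y : (F × F) × (F × F)}
    (h : bottomLine x = bottomLine y) : ∃ u : F, u • x = y := by
  have hy : bottomPair y ∈ bottomLine x := h ▸ ⟨1, by simp⟩
  obtain ⟨u, hu⟩ := hy
  exact ⟨u, bottomPair_injective hu⟩

theorem lineRep_ne_zero (o : Option F) : lineRep o ≠ 0 := by
  cases o <;> simp [lineRep, Prod.ext_iff]

theorem exists_smul_lineRep {z : F × F} (hz : z ≠ 0) :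
    ∃ u : F, u ≠ 0 ∧ ∃ o, z = u • lineRep o := by
  obtain ⟨a, b⟩ := z
  by_cases ha : a = 0
  · subst ha
    exact ⟨b, by rintro rfl; exact hz rfl, none, by simp [lineRep]⟩
  · exact ⟨a, ha, some (a⁻¹ * b), by simp [lineRep, ha]⟩

theorem smul_lineRep_eq {u : F} {o o' : Option F} (h : u • lineRep o = lineRep o') :
    u = 1 ∧ o = o' := by
  cases o <;> cases o' <;> simp_all [lineRep] <;> aesop

theorem bottomLine_lineRep_injective :
    Function.Injective fun o : Option F => bottomLine (lineRep o, 0) := by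
  intro o o' h
  obtain ⟨u, hu⟩ := exists_smul_eq_of_bottomLine_eq h
  exact (smul_lineRep_eq (congrArg Prod.fst hu)).2

theorem bottomLine_prod_lineRep_injective :
    Function.Injective fun p : (F × F) × Option F => bottomLine (p.1, lineRep p.2) := by
  rintro ⟨w, o⟩ ⟨w', o'⟩ h
  obtain ⟨u, hu⟩ := exists_smul_eq_of_bottomLine_eq h
  obtain ⟨rfl, rfl⟩ := smul_lineRep_eq (congrArg Prod.snd hu)
  have hw : (1 : F) • w = w' := congrArg Prod.fst hu
  rw [← hw, one_smul]

variable [Fintype F]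

theorem ncard_bottomLine {x : (F × F) × (F × F)} (hx : x ≠ 0) :
    (bottomLine x).ncard = Fintype.card F := by
  have hinj : Function.Injective fun u : F => bottomPair (u • x) :=
    bottomPair_injective.comp (smul_left_injective F hx)
  rw [bottomLine, Set.ncard_range_of_injective hinj, Nat.card_eq_fintype_card]

theorem ne_zero_of_ncard_bottomLine {x : (F × F) × (F × F)}
    (hx : (bottomLine x).ncard = Fintype.card F) : x ≠ 0 := by
  rintro rfl
  have h1 := Fintype.one_lt_card (α := F)
  simp [bottomLine] at hx
  omega

theorem card_sq_le_ncard_cyc {P R : Mat 2 F} (h : P 0 0 ≠ 0 ∨ R 0 0 ≠ 0) :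
    Fintype.card F ^ 2 ≤ (cyc P R).ncard := by
  let f : F × F → Mat 2 F × Mat 2 F := fun p =>
    (!![p.1, 0; p.2, 0] * P, !![p.1, 0; p.2, 0] * R)
  have hf : Function.Injective f := by
    rintro ⟨s, t⟩ ⟨s', t'⟩ hst
    simp only [f, Prod.mk.injEq] at hst
    have hP := fun i => congrFun₂ hst.1 i 0
    have hR := fun i => congrFun₂ hst.2 i 0
    have hP0 := hP 0
    have hP1 := hP 1
    have hR0 := hR 0
    have hR1 := hR 1
    simp [Matrix.mul_apply, Fin.sum_univ_two] at hP0 hP1 hR0 hR1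
    grind
  have hsub : Set.range f ⊆ cyc P R := by
    rintro _ ⟨p, rfl⟩
    refine ⟨!![p.1, 0; p.2, 0], ?_, rfl⟩
    intro i j hij
    fin_cases i <;> fin_cases j <;> simp_all
  have := Set.ncard_le_ncard hsub (Set.toFinite _)
  rwa [Set.ncard_range_of_injective hf, Nat.card_eq_fintype_card, Fintype.card_prod, ← sq] at this

theorem exists_bottomPair_of_ncard_cyc {P R : Mat 2 F} (hP : LowerTri P) (hR : LowerTri R)
    (h : (cyc P R).ncard = Fintype.card F) :
    P 0 0 = 0 ∧ R 0 0 = 0 ∧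
      cyc P R = bottomLine ((P 1 0, R 1 0), (P 1 1, R 1 1)) := by
  have h0 : P 0 0 = 0 ∧ R 0 0 = 0 := by
    by_contra hne
    have := card_sq_le_ncard_cyc (not_and_or.mp hne)
    have h1 := Fintype.one_lt_card (α := F)
    nlinarith
  refine ⟨h0.1, h0.2, ?_⟩
  rw [← cyc_bottomPair, ← eq_bottomPair hP hR h0.1 h0.2]

end LowerTriangularPairs

theorem stmt_5 (q : ℕ) (hq : 2 ≤ q)
    (F : Type) [Field F] [Fintype F] (hF : Fintype.card F = q) :
    Set.ncard {M : Set (Mat 2 F × Mat 2 F) |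
        Set.ncard M = q ∧
        ∃ P R : Mat 2 F, LowerTri P ∧ LowerTri R ∧
          (∀ i : Fin 2, P i i = 0) ∧ (∀ i : Fin 2, R i i = 0) ∧ M = cyc P R}
      = q + 1 ∧
    Set.ncard {M : Set (Mat 2 F × Mat 2 F) |
        Set.ncard M = q ∧
        ∃ P R : Mat 2 F, LowerTri P ∧ LowerTri R ∧
          (∃ i : Fin 2, P i i ≠ 0 ∨ R i i ≠ 0) ∧ M = cyc P R}
      = q ^ 2 * (q + 1) := by
  subst hF
  constructor
  · convert Set.ncard_range_of_injective (bottomLine_lineRep_injective (F := F)) using 1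
    · congr 1
      ext M
      constructor
      · rintro ⟨hM, P, R, hP, hR, hP0, hR0, rfl⟩
        have hL := (exists_bottomPair_of_ncard_cyc hP hR hM).2.2
        rw [hL] at hM ⊢
        have hx := ne_zero_of_ncard_bottomLine hM
        rw [hP0, hR0] at hx ⊢
        have hw : (P 1 0, R 1 0) ≠ 0 := fun hw => hx (by rw [hw]; rfl)
        obtain ⟨u, hu, o, ho⟩ := exists_smul_lineRep hw
        refine ⟨o, ?_⟩
        rw [ho]
        simpa [← Prod.mk_zero_zero] using (bottomLine_smul hu (lineRep o, 0)).symm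
      · rintro ⟨o, rfl⟩
        refine ⟨ncard_bottomLine fun h => lineRep_ne_zero o (congrArg Prod.fst h),
          _, _, (lowerTri_bottomPair _).1, (lowerTri_bottomPair _).2, ?_, ?_,
          (cyc_bottomPair _).symm⟩ <;>
        · intro i
          fin_cases i <;> simp [bottomPair]
    · simp
  · convert Set.ncard_range_of_injective (bottomLine_prod_lineRep_injective (F := F)) using 1
    · congr 1
      ext M
      constructor
      · rintro ⟨hM, P, R, hP, hR, ⟨i, hi⟩, rfl⟩
        obtain ⟨hP0, hR0, hL⟩ := exists_bottomPair_of_ncard_cyc hP hR hM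
        have hz : (P 1 1, R 1 1) ≠ 0 := by
          fin_cases i <;> simp_all [imp_iff_not_or]
        obtain ⟨u, hu, o, ho⟩ := exists_smul_lineRep hz
        refine ⟨(u⁻¹ • (P 1 0, R 1 0), o), ?_⟩
        rw [hL, ho]
        simpa [hu] using (bottomLine_smul hu (u⁻¹ • (P 1 0, R 1 0), lineRep o)).symm
      · rintro ⟨⟨w, o⟩, rfl⟩
        have ho := lineRep_ne_zero o
        refine ⟨ncard_bottomLine fun h => ho (congrArg Prod.snd h),
          _, _, (lowerTri_bottomPair _).1, (lowerTri_bottomPair _).2, ⟨1, ?_⟩,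
          (cyc_bottomPair _).symm⟩
        by_contra! h
        exact ho (Prod.ext (by simpa [bottomPair] using h.1) (by simpa [bottomPair] using h.2))
    · simp [sq]
end

section
/- Let (X,Y) = ((x11,0; x21,x22), (y11,0; y21,y22)) ∈ ²T(q) be a unimodular pair, and let p21, p22, r21, r22 ∈ F with (p22, r22) ≠ (0, 0). If T(q)((0,0; p21,p22), (0,0; r21,r22)) ⊆ T(q)(X,Y), then there exists u ∈ F with u ≠ 0 such that p22 = u·x22 and r22 = u·y22. -/
open Matrix

theorem stmt_8 (q : ℕ) (hq : 2 ≤ q)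
    (F : Type) [Field F] [Fintype F] (hF : Fintype.card F = q)
    (x11 x21 x22 y11 y21 y22 p21 p22 r21 r22 : F)
    (huni : Unimodular !![x11, 0; x21, x22] !![y11, 0; y21, y22])
    (hpr : (p22, r22) ≠ (0, 0))
    (hsub : cyc !![0, 0; p21, p22] !![0, 0; r21, r22]
      ⊆ cyc !![x11, 0; x21, x22] !![y11, 0; y21, y22]) :
    ∃ u : F, u ≠ 0 ∧ p22 = u * x22 ∧ r22 = u * y22 := by
  obtain ⟨A, -, hA⟩ := hsub ⟨1, fun i j hij => Matrix.one_apply_ne hij.ne, rfl⟩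
  simp only [one_mul, Prod.mk.injEq] at hA
  have hp : p22 = A 1 1 * x22 := by
    simpa [Matrix.mul_apply, Fin.sum_univ_two] using congrFun (congrFun hA.1 1) 1
  have hr : r22 = A 1 1 * y22 := by
    simpa [Matrix.mul_apply, Fin.sum_univ_two] using congrFun (congrFun hA.2 1) 1
  refine ⟨A 1 1, fun hu => hpr ?_, hp, hr⟩
  simp [hp, hr, hu]
end

section
/- Let N be a free cyclic submodule of ²T(q) generated by a non-unimodular pair. Then: (i) for all p21, r21 ∈ F, the cyclic submodule T(q)((0,0; p21,0), (0,0; r21,0)) is contained in N; and (ii) for all p21, p22, r21, r22 ∈ F with (p22, r22) ≠ (0, 0), the cyclic submodule T(q)((0,0; p21,p22), (0,0; r21,r22)) is not contained in N. -/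
open Matrix

theorem lowerTri_fin_two {F : Type} [Zero F] (a b c : F) : LowerTri !![a, 0; b, c] := by
  intro i j h
  fin_cases i <;> fin_cases j <;> simp_all

theorem LowerTri.exists_eq {F : Type} [Zero F] {X : Mat 2 F} (h : LowerTri X) :
    ∃ a b c : F, X = !![a, 0; b, c] := by
  refine ⟨X 0 0, X 1 0, X 1 1, ?_⟩
  rw [← h 0 1 (by decide)]
  exact Matrix.eta_fin_two X

/-- A free non-unimodular pair has vanishing second diagonal entries and linearly independent
first columns. -/
theorem IsFreePair.of_not_unimodular {F : Type} [Field F] {a b c a' b' c' : F}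
    (hfree : IsFreePair !![a, 0; b, c] !![a', 0; b', c'])
    (hU : ¬ Unimodular !![a, 0; b, c] !![a', 0; b', c']) :
    c = 0 ∧ c' = 0 ∧ a * b' - b * a' ≠ 0 := by
  have key : ∀ s t : F, s * a + t * b = 0 → t * c = 0 → s * a' + t * b' = 0 → t * c' = 0 →
      s = 0 ∧ t = 0 := by
    intro s t h1 h2 h3 h4
    have h := hfree !![0, 0; s, t] (lowerTri_fin_two _ _ _)
      (by ext i j; fin_cases i <;> fin_cases j <;> simp [h1, h2])
      (by ext i j; fin_cases i <;> fin_cases j <;> simp [h3, h4])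
    exact ⟨by simpa using congrFun (congrFun h 1) 0, by simpa using congrFun (congrFun h 1) 1⟩
  have ha : ¬ (a = 0 ∧ a' = 0) := by
    rintro ⟨rfl, rfl⟩
    exact one_ne_zero (key 1 0 (by simp) (by simp) (by simp) (by simp)).1
  have hc : c = 0 ∧ c' = 0 := by
    by_contra hc
    refine hU fun i => ?_
    fin_cases i
    · simpa [imp_iff_not_or] using ha
    · simpa [imp_iff_not_or] using hc
  obtain ⟨rfl, rfl⟩ := hc
  refine ⟨rfl, rfl, fun hd => ha ⟨?_, ?_⟩⟩
  · exact (key (-b) a (by ring) (by simp) (by linear_combination hd) (by simp)).2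
  · exact (key (-b') a' (by linear_combination -hd) (by simp) (by ring) (by simp)).2

theorem stmt_10 (q : ℕ) (hq : 2 ≤ q)
    (F : Type) [Field F] [Fintype F] (hF : Fintype.card F = q)
    (N : Set (Mat 2 F × Mat 2 F)) (hN : IsNonUnimodFreeCyc N) :
    (∀ p21 r21 : F, cyc !![0, 0; p21, 0] !![0, 0; r21, 0] ⊆ N) ∧
    (∀ p21 p22 r21 r22 : F, (p22, r22) ≠ (0, 0) →
      ¬ cyc !![0, 0; p21, p22] !![0, 0; r21, r22] ⊆ N) := by
  obtain ⟨X, Y, hX, hY, hU, hfree, rfl⟩ := hN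
  obtain ⟨a, b, c, rfl⟩ := hX.exists_eq
  obtain ⟨a', b', c', rfl⟩ := hY.exists_eq
  obtain ⟨rfl, rfl, hd⟩ := hfree.of_not_unimodular hU
  constructor
  · rintro p r _ ⟨A, hA, rfl⟩
    obtain ⟨u, v, w, rfl⟩ := hA.exists_eq
    refine ⟨!![0, 0; w * (p * b' - r * b) / (a * b' - b * a'),
      w * (a * r - a' * p) / (a * b' - b * a')], lowerTri_fin_two _ _ _, Prod.ext ?_ ?_⟩
    · ext i j
      fin_cases i <;> fin_cases j <;> simp
      rw [div_mul_eq_mul_div, div_mul_eq_mul_div, ← add_div, eq_div_iff hd]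
      ring
    · ext i j
      fin_cases i <;> fin_cases j <;> simp
      rw [div_mul_eq_mul_div, div_mul_eq_mul_div, ← add_div, eq_div_iff hd]
      ring
  · intro p p' r r' hne hsub
    obtain ⟨A, -, hA⟩ := hsub ⟨1, fun i j h => Matrix.one_apply_ne h.ne, rfl⟩
    rw [one_mul, one_mul, Prod.mk.injEq] at hA
    refine hne (Prod.ext ?_ ?_)
    · simpa [Matrix.mul_apply] using congrFun (congrFun hA.1 1) 1
    · simpa [Matrix.mul_apply] using congrFun (congrFun hA.2 1) 1
end
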